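/- Let V ⊂ ℝ^r be open and star shaped with centre z, and let α ∈ A^k(V) = ⊕_{p+q=k} A^{p,q}(V) satisfy dα = 0 where d = d' + d''. Then there exists β ∈ A^{k−1}(V) such that α − dβ ∈ A^{0,k}(V), and α − dβ is closed under d', d'' and d. If moreover k > r, then α is d-exact. -/

import Mathlib

open Set

noncomputable section

abbrev Vec (r : ℕ) : Type := Fin r → ℝ

/-- The data of a superform of bidegree `(p,q)` on `ℝ^r`: a pointwise evaluation
on `p` tangent vectors (the `d'`-block) and `q` tangent vectors (the `d''`-block). -/
abbrev SFd (r p q : ℕ) : Type :=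
  Vec r → (Fin p → Vec r) → (Fin q → Vec r) → ℝ

/-- `g` is multilinear and alternating in its `n` vector arguments. -/
def IsAltML {r n : ℕ} (g : (Fin n → Vec r) → ℝ) : Prop :=
  (∀ (v : Fin n → Vec r) (i : Fin n) (x y : Vec r),
      g (Function.update v i (x + y)) =
        g (Function.update v i x) + g (Function.update v i y)) ∧
  (∀ (v : Fin n → Vec r) (i : Fin n) (c : ℝ) (x : Vec r),
      g (Function.update v i (c • x)) = c * g (Function.update v i x)) ∧
  (∀ (v : Fin n → Vec r) (i j : Fin n), i ≠ j → v i = v j → g v = 0)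

/-- `α` is a smooth superform of bidegree `(p,q)` on the set `U ⊆ ℝ^r`. -/
def IsSuperformOn {r p q : ℕ} (U : Set (Vec r)) (α : SFd r p q) : Prop :=
  (∀ x ∈ U, ∀ w, IsAltML fun v => α x v w) ∧
  (∀ x ∈ U, ∀ v, IsAltML fun w => α x v w) ∧
  ∀ v w, ContDiffOn ℝ (⊤ : ℕ∞) (fun x => α x v w) U

/-- The differential `d'` of superforms, acting on the `d'`-block. -/
def dP {r p q : ℕ} (α : SFd r p q) : SFd r (p + 1) q := fun x v w =>
  ∑ i : Fin (p + 1),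
    (-1 : ℝ) ^ (i : ℕ) * fderiv ℝ (fun y => α y (v ∘ i.succAbove) w) x (v i)

/-- The differential `d''` of superforms, acting on the `d''`-block,
with the sign `(-1)^p`. -/
def dPP {r p q : ℕ} (α : SFd r p q) : SFd r p (q + 1) := fun x v w =>
  (-1 : ℝ) ^ p * ∑ j : Fin (q + 1),
    (-1 : ℝ) ^ (j : ℕ) * fderiv ℝ (fun y => α y v (w ∘ j.succAbove)) x (w j)

/-- The data of a mixed-degree superform on `ℝ^r`, given by components in every
bidegree `(p,q)`. -/
abbrev Tot (r : ℕ) : Type := ∀ p q : ℕ, SFd r p q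

/-- The operator `d'` on mixed-degree superforms (componentwise). -/
def Dp {r : ℕ} (α : Tot r) : Tot r := fun p q =>
  match p with
  | 0 => fun _ _ _ => 0
  | p' + 1 => dP (α p' q)

/-- The operator `d''` on mixed-degree superforms (componentwise). -/
def Dpp {r : ℕ} (α : Tot r) : Tot r := fun p q =>
  match q with
  | 0 => fun _ _ _ => 0
  | q' + 1 => dPP (α p q')

/-- The total differential `d = d' + d''` on mixed-degree superforms. -/
def Dtot {r : ℕ} (α : Tot r) : Tot r := fun p q x v w =>
  Dp α p q x v w + Dpp α p q x v w

/-- `α` is homogeneous of total degree `k` on `V`: all components of bidegree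
`(p,q)` with `p + q ≠ k` vanish on `V`. -/
def IsHomogOn {r : ℕ} (V : Set (Vec r)) (k : ℕ) (α : Tot r) : Prop :=
  ∀ p q : ℕ, p + q ≠ k → ∀ x ∈ V, ∀ v w, α p q x v w = 0

section Material

open scoped ContDiff Topology

/-- Differentiation under the integral sign for an integrand that is `C^1` near
`{x} × [0,1]`. -/
theorem hasFDerivAt_integral_of_contDiffOn {E G : Type*} [NormedAddCommGroup E] [NormedSpace ℝ E]
    [ProperSpace E] [NormedAddCommGroup G] [NormedSpace ℝ G]
    {U : Set E} {W : Set (E × ℝ)} (hU : IsOpen U) (hW : IsOpen W)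
    (hUW : U ×ˢ Icc (0 : ℝ) 1 ⊆ W) {f : E × ℝ → G} (hf : ContDiffOn ℝ 1 f W) {x : E}
    (hx : x ∈ U) :
    HasFDerivAt (fun y => ∫ t in (0 : ℝ)..1, f (y, t))
      (∫ t in (0 : ℝ)..1, (fderiv ℝ f (x, t)).comp (ContinuousLinearMap.inl ℝ E ℝ)) x := by
  obtain ⟨ε, hε, hball⟩ := Metric.nhds_basis_closedBall.mem_iff.1 (hU.mem_nhds hx)
  have hI : uIoc (0 : ℝ) 1 ⊆ Icc 0 1 := by
    rw [uIoc_of_le zero_le_one]; exact Ioc_subset_Icc_self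
  have hf' : ContinuousOn (fun a => (fderiv ℝ f a).comp (ContinuousLinearMap.inl ℝ E ℝ)) W :=
    (hf.continuousOn_fderiv_of_isOpen hW le_rfl).clm_comp continuousOn_const
  have hslice : ∀ y ∈ U, MapsTo (fun t : ℝ => (y, t)) (Icc 0 1) W :=
    fun y hy t ht => hUW ⟨hy, ht⟩
  have hpair : ∀ y : E, Continuous fun t : ℝ => (y, t) := fun y => by fun_prop
  have hF : ∀ y ∈ U, ContinuousOn (fun t : ℝ => f (y, t)) (Icc 0 1) := fun y hy =>
    hf.continuousOn.comp (hpair y).continuousOn (hslice y hy)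
  have hF' : ContinuousOn (fun t : ℝ =>
      (fderiv ℝ f (x, t)).comp (ContinuousLinearMap.inl ℝ E ℝ)) (Icc 0 1) :=
    hf'.comp (hpair x).continuousOn (hslice x hx)
  obtain ⟨C, hC⟩ := ((isCompact_closedBall x ε).prod (isCompact_Icc (a := (0 : ℝ)) (b := 1))
    ).exists_bound_of_continuousOn (hf'.mono ((prod_mono hball le_rfl).trans hUW))
  refine intervalIntegral.hasFDerivAt_integral_of_dominated_of_fderiv_le
    (F := fun y t => f (y, t))
    (F' := fun y t => (fderiv ℝ f (y, t)).comp (ContinuousLinearMap.inl ℝ E ℝ))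
    (bound := fun _ => C)
    (Metric.closedBall_mem_nhds x hε) ?_ ?_ ?_ ?_ (by simp) ?_
  · filter_upwards [hU.mem_nhds hx] with y hy
    exact ((hF y hy).mono hI).aestronglyMeasurable measurableSet_uIoc
  · exact (hF x hx).intervalIntegrable_of_Icc zero_le_one
  · exact (hF'.mono hI).aestronglyMeasurable measurableSet_uIoc
  · exact .of_forall fun t ht y hy => hC (y, t) ⟨hy, hI ht⟩
  · refine .of_forall fun t ht y hy => ?_
    have h1 : HasFDerivAt f (fderiv ℝ f (y, t)) (y, t) :=
      ((hf.contDiffAt (hW.mem_nhds (hUW ⟨hball hy, hI ht⟩))).differentiableAt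
        one_ne_zero).hasFDerivAt
    exact h1.comp y (hasFDerivAt_prodMk_left y t)

/-- Smooth dependence of an integral over `[0,1]` on a parameter. -/
theorem contDiffOn_integral {E G : Type} [NormedAddCommGroup E] [NormedSpace ℝ E]
    [ProperSpace E] [NormedAddCommGroup G] [NormedSpace ℝ G]
    {U : Set E} {W : Set (E × ℝ)} (hU : IsOpen U) (hW : IsOpen W)
    (hUW : U ×ˢ Icc (0 : ℝ) 1 ⊆ W) {f : E × ℝ → G} (hf : ContDiffOn ℝ ∞ f W) :
    ContDiffOn ℝ ∞ (fun y => ∫ t in (0 : ℝ)..1, f (y, t)) U := by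
  refine contDiffOn_infty.2 fun n => ?_
  induction n generalizing G with
  | zero =>
    exact contDiffOn_zero.2 fun x hx => (hasFDerivAt_integral_of_contDiffOn hU hW hUW
      (hf.of_le (mod_cast le_top)) hx).continuousAt.continuousWithinAt
  | succ n ih =>
    have hf' : ContDiffOn ℝ ∞
        (fun a => (fderiv ℝ f a).comp (ContinuousLinearMap.inl ℝ E ℝ)) W :=
      (hf.fderiv_of_isOpen hW le_rfl).clm_comp contDiffOn_const
    push_cast
    refine (contDiffOn_succ_iff_hasFDerivWithinAt_of_uniqueDiffOn hU.uniqueDiffOn).2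
      ⟨by simp, _, ih hf', fun x hx => (hasFDerivAt_integral_of_contDiffOn hU hW hUW
        (hf.of_le (mod_cast le_top)) hx).hasFDerivWithinAt⟩

section RadialHomotopy

variable {E G₀ G₁ : Type} [NormedAddCommGroup E] [NormedSpace ℝ E]
  [NormedAddCommGroup G₀] [NormedSpace ℝ G₀] [NormedAddCommGroup G₁] [NormedSpace ℝ G₁]
  {V : Set E} {z : E} {η : E → G₁}

theorem isOpen_preimage_segment (hV : IsOpen V) :
    IsOpen ((fun a : E × ℝ => z + a.2 • (a.1 - z)) ⁻¹' V) :=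
  hV.preimage (by fun_prop)

theorem contDiffOn_radialIntegrand (n : ℕ) (c : G₁ →L[ℝ] E →L[ℝ] G₀) (hη : ContDiffOn ℝ ∞ η V) :
    ContDiffOn ℝ ∞ (fun a : E × ℝ => a.2 ^ n • c (η (z + a.2 • (a.1 - z))) (a.1 - z))
      ((fun a : E × ℝ => z + a.2 • (a.1 - z)) ⁻¹' V) := by
  have h1 : ContDiff ℝ ∞ fun a : E × ℝ => z + a.2 • (a.1 - z) := by fun_prop
  have h2 := hη.comp h1.contDiffOn (fun _ h => h)
  have h3 := c.contDiff.comp_contDiffOn h2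
  exact ContDiffOn.smul (by fun_prop) (h3.clm_apply (by fun_prop))

theorem contDiffOn_radialHomotopy [ProperSpace E] (n : ℕ) (c : G₁ →L[ℝ] E →L[ℝ] G₀)
    (hV : IsOpen V) (hstar : ∀ x ∈ V, ∀ t ∈ Icc (0 : ℝ) 1, z + t • (x - z) ∈ V)
    (hη : ContDiffOn ℝ ∞ η V) :
    ContDiffOn ℝ ∞
      (fun x => ∫ t in (0 : ℝ)..1, t ^ n • c (η (z + t • (x - z))) (x - z)) V :=
  contDiffOn_integral hV (isOpen_preimage_segment hV) (fun a ha => hstar a.1 ha.1 a.2 ha.2)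
    (contDiffOn_radialIntegrand n c hη)

/-- The homotopy formula for closed forms, with currying `c` and alternatization `a` kept
abstract. -/
theorem alternatize_fderiv_radialHomotopy [ProperSpace E] [CompleteSpace G₀] [CompleteSpace G₁]
    (n : ℕ) (c : G₁ →L[ℝ] E →L[ℝ] G₀) (a : (E →L[ℝ] G₀) →L[ℝ] G₁)
    (hac : ∀ g, a (c g) = ((n : ℝ) + 1) • g)
    (hV : IsOpen V) (hstar : ∀ x ∈ V, ∀ t ∈ Icc (0 : ℝ) 1, z + t • (x - z) ∈ V)
    (hη : ContDiffOn ℝ ∞ η V)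
    (hclosed : ∀ x ∈ V, ∀ w, a ((c ∘L fderiv ℝ η x).flip w) = fderiv ℝ η x w)
    {x : E} (hx : x ∈ V) :
    a (fderiv ℝ (fun x => ∫ t in (0 : ℝ)..1, t ^ n • c (η (z + t • (x - z))) (x - z)) x) =
      η x := by
  set f : E × ℝ → G₀ := fun a => a.2 ^ n • c (η (z + a.2 • (a.1 - z))) (a.1 - z) with hf
  have hW := isOpen_preimage_segment (z := z) hV
  have hUW : V ×ˢ Icc (0 : ℝ) 1 ⊆ (fun a : E × ℝ => z + a.2 • (a.1 - z)) ⁻¹' V :=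
    fun a ha => hstar a.1 ha.1 a.2 ha.2
  have hfs : ContDiffOn ℝ 1 f _ := (contDiffOn_radialIntegrand n c hη).of_le (mod_cast le_top)
  have hd := hasFDerivAt_integral_of_contDiffOn hV hW hUW hfs hx
  have hηd : ∀ t ∈ Icc (0 : ℝ) 1, HasFDerivAt η (fderiv ℝ η (z + t • (x - z)))
      (z + t • (x - z)) := fun t ht =>
    ((hη.contDiffAt (hV.mem_nhds (hstar x hx t ht))).differentiableAt (by simp)).hasFDerivAt
  have hcont : ContinuousOn (fun t : ℝ =>
      (fderiv ℝ f (x, t)).comp (ContinuousLinearMap.inl ℝ E ℝ)) (Icc 0 1) :=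
    ((hfs.continuousOn_fderiv_of_isOpen hW le_rfl).clm_comp continuousOn_const).comp
      (f := fun t : ℝ => (x, t)) (by fun_prop) (fun t ht => hUW ⟨hx, ht⟩)
  have key : ∀ t ∈ Icc (0 : ℝ) 1,
      a ((fderiv ℝ f (x, t)).comp (ContinuousLinearMap.inl ℝ E ℝ)) =
      t ^ (n + 1) • fderiv ℝ η (z + t • (x - z)) (x - z) +
        (((n : ℝ) + 1) * t ^ n) • η (z + t • (x - z)) := by
    intro t ht
    have h1 : HasFDerivAt (fun y => f (y, t))
        ((fderiv ℝ f (x, t)).comp (ContinuousLinearMap.inl ℝ E ℝ)) x :=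
      (((hfs.contDiffAt (hW.mem_nhds (hUW ⟨hx, ht⟩))).differentiableAt
        one_ne_zero).hasFDerivAt).comp x (hasFDerivAt_prodMk_left x t)
    have h2 : HasFDerivAt (fun y : E => z + t • (y - z)) (t • ContinuousLinearMap.id ℝ E) x :=
      (((hasFDerivAt_id x).sub_const z).const_smul t).const_add z
    have h3 := c.hasFDerivAt.comp x ((hηd t ht).comp x h2)
    have h4 := (h3.clm_apply ((hasFDerivAt_id x).sub_const z)).const_smul (t ^ n)
    have h5 : (c ∘L fderiv ℝ η (z + t • (x - z)) ∘L (t • ContinuousLinearMap.id ℝ E)).flip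
        (x - z) = t • (c ∘L fderiv ℝ η (z + t • (x - z))).flip (x - z) := by
      ext u; simp
    rw [h1.unique h4]
    simp only [id, Function.comp_apply, ContinuousLinearMap.comp_id, map_smul, map_add, h5,
      hclosed _ (hstar x hx t ht), hac]
    module
  have hFTC : ∀ t ∈ uIcc (0 : ℝ) 1, HasDerivAt (fun t : ℝ => t ^ (n + 1) • η (z + t • (x - z)))
      (a ((fderiv ℝ f (x, t)).comp (ContinuousLinearMap.inl ℝ E ℝ))) t := by
    intro t ht
    rw [uIcc_of_le zero_le_one] at ht
    rw [key t ht]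
    have h2 : HasDerivAt (fun t : ℝ => z + t • (x - z)) (x - z) t := by
      simpa using ((hasDerivAt_id t).smul_const (x - z)).const_add z
    refine ((hasDerivAt_pow (n + 1) t).smul ((hηd t ht).comp_hasDerivAt t h2)).congr_deriv ?_
    rw [Nat.add_sub_cancel, Nat.cast_succ]
    rfl
  rw [hd.fderiv, ← ContinuousLinearMap.intervalIntegral_comp_comm _
      (hcont.intervalIntegrable_of_Icc zero_le_one),
    intervalIntegral.integral_eq_sub_of_hasDerivAt hFTC
      ((a.continuous.comp_continuousOn hcont).intervalIntegrable_of_Icc zero_le_one)]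
  simp

end RadialHomotopy

section Poincare

variable {E : Type} [NormedAddCommGroup E] [NormedSpace ℝ E] {n : ℕ}

/-- Cartan's formula, at the level of the first derivative `A` of a closed form. -/
theorem alternatizeUncurryFin_curryLeft_flip
    (A : E →L[ℝ] E [⋀^Fin (n + 1)]→L[ℝ] ℝ)
    (hA : ContinuousAlternatingMap.alternatizeUncurryFin A = 0) (w : E) :
    ContinuousAlternatingMap.alternatizeUncurryFin
      (((ContinuousAlternatingMap.curryLeftLI (𝕜 := ℝ) (E := E) (F := ℝ)
        (n := n)).toContinuousLinearMap ∘L A).flip w) = A w := by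
  ext v
  have h := congrArg (fun φ => φ (Fin.cons w v)) hA
  have h2 : ∀ i : Fin (n + 1), (Fin.succ i).removeNth (Fin.cons w v : Fin (n + 2) → E) =
      Fin.cons w (i.removeNth v) := fun i => by
    ext j
    refine Fin.cases ?_ (fun j => ?_) j <;> simp [Fin.removeNth]
  simp only [ContinuousAlternatingMap.alternatizeUncurryFin_apply, Fin.sum_univ_succ (n := n + 1),
    ContinuousAlternatingMap.coe_zero, Pi.zero_apply, Fin.cons_zero, Fin.cons_succ,
    Fin.val_zero, pow_zero, one_smul, Fin.val_succ, pow_succ, Fin.removeNth_zero,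
    Fin.tail_cons, h2, mul_neg, mul_one, neg_smul, Finset.sum_neg_distrib] at h
  simp only [ContinuousAlternatingMap.alternatizeUncurryFin_apply]
  exact (add_neg_eq_zero.1 h).symm

/-- The Poincaré lemma on star shaped open sets. -/
theorem extDeriv_radialHomotopy [ProperSpace E] {V : Set E} {z : E}
    {η : E → E [⋀^Fin (n + 1)]→L[ℝ] ℝ} (hV : IsOpen V)
    (hstar : ∀ x ∈ V, ∀ t ∈ Icc (0 : ℝ) 1, z + t • (x - z) ∈ V)
    (hη : ContDiffOn ℝ ∞ η V) (hclosed : ∀ x ∈ V, extDeriv η x = 0) {x : E} (hx : x ∈ V) :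
    extDeriv (fun x => ∫ t in (0 : ℝ)..1, t ^ n • (η (z + t • (x - z))).curryLeft (x - z)) x =
      η x :=
  alternatize_fderiv_radialHomotopy n
    (ContinuousAlternatingMap.curryLeftLI (𝕜 := ℝ) (E := E) (F := ℝ)
      (n := n)).toContinuousLinearMap
    (ContinuousAlternatingMap.alternatizeUncurryFinCLM ℝ E ℝ)
    (fun g => (ContinuousAlternatingMap.alternatizeUncurryFin_curryLeft g).trans
      (by rw [← Nat.cast_smul_eq_nsmul ℝ]; push_cast; rfl))
    hV hstar hη (fun x hx w => alternatizeUncurryFin_curryLeft_flip _ (hclosed x hx) w) hx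

end Poincare

section Form

variable {r n : ℕ} {V : Set (Vec r)} {g : Vec r → (Fin n → Vec r) → ℝ} {x : Vec r}

/-- An alternating multilinear function of vectors, as an alternating map. -/
def IsAltML.toAlternatingMap {g : (Fin n → Vec r) → ℝ} (hg : IsAltML g) :
    Vec r [⋀^Fin n]→ₗ[ℝ] ℝ where
  toFun := g
  map_update_add' {inst} v i x y := by
    cases Subsingleton.elim inst (instDecidableEqFin n)
    exact hg.1 v i x y
  map_update_smul' {inst} v i c x := by
    cases Subsingleton.elim inst (instDecidableEqFin n)
    exact hg.2.1 v i c x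
  map_eq_zero_of_eq' v i j hv hij := hg.2.2 v i j hij hv

theorem AlternatingMap.continuous_of_pi (g : Vec r [⋀^Fin n]→ₗ[ℝ] ℝ) : Continuous g := by
  have h : ∀ v, g v = ∑ s : Fin n → Fin r,
      (∏ i, v i (s i)) * g fun i => Pi.single (s i) 1 := fun v => by
    conv_lhs => rw [show v = fun i => ∑ j, v i j • (Pi.single j 1 : Vec r) from
      funext fun i => pi_eq_sum_univ' (v i)]
    rw [← AlternatingMap.coe_multilinearMap, MultilinearMap.map_sum]
    exact Finset.sum_congr rfl fun s _ => MultilinearMap.map_smul_univ _ _ _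
  rw [show (g : (Fin n → Vec r) → ℝ) = _ from funext h]
  fun_prop

/-- An alternating multilinear function of vectors, as a continuous alternating map. -/
def IsAltML.toContinuousAlternatingMap {g : (Fin n → Vec r) → ℝ} (hg : IsAltML g) :
    Vec r [⋀^Fin n]→L[ℝ] ℝ :=
  ⟨⟨hg.toAlternatingMap.toMultilinearMap, hg.toAlternatingMap.continuous_of_pi⟩,
    hg.toAlternatingMap.map_eq_zero_of_eq'⟩

theorem AlternatingMap.eq_zero_of_lt (g : Vec r [⋀^Fin n]→ₗ[ℝ] ℝ) (h : r < n)
    (v : Fin n → Vec r) : g v = 0 :=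
  g.map_linearDependent v fun hv => by
    have := hv.fintype_card_le_finrank
    rw [Fintype.card_fin, Module.finrank_fin_fun] at this
    omega

/-- An alternating map on `ℝ^r` is determined by its values on basis vectors. -/
def basisEval (r n : ℕ) : (Vec r [⋀^Fin n]→L[ℝ] ℝ) →ₗ[ℝ] ((Fin n → Fin r) → ℝ) where
  toFun g s := g fun i => Pi.single (s i) 1
  map_add' _ _ := rfl
  map_smul' _ _ := rfl

theorem basisEval_injective : Function.Injective (basisEval r n) := fun g h hgh => by
  refine ContinuousAlternatingMap.toAlternatingMap_injective
    (AlternatingMap.coe_multilinearMap_injective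
      (Module.Basis.ext_multilinear (fun _ => Pi.basisFun ℝ (Fin r)) fun s => ?_))
  simpa [basisEval] using congrFun hgh s

open Classical in
/-- A pointwise alternating family of functions as a differential form, extended by zero. -/
def toForm (g : Vec r → (Fin n → Vec r) → ℝ) (x : Vec r) : Vec r [⋀^Fin n]→L[ℝ] ℝ :=
  if h : IsAltML (g x) then h.toContinuousAlternatingMap else 0

/-- `g` is a smooth differential form on `V`. -/
def IsFormOn (V : Set (Vec r)) (g : Vec r → (Fin n → Vec r) → ℝ) : Prop :=
  (∀ x ∈ V, IsAltML (g x)) ∧ ∀ v, ContDiffOn ℝ ∞ (fun x => g x v) V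

theorem toForm_apply (h : IsAltML (g x)) (v : Fin n → Vec r) : toForm g x v = g x v := by
  rw [toForm, dif_pos h]; rfl

theorem isAltML_coe (φ : Vec r [⋀^Fin n]→L[ℝ] ℝ) : IsAltML φ :=
  ⟨φ.map_update_add, φ.map_update_smul, fun v _ _ hij hv => φ.map_eq_zero_of_eq v hv hij⟩

theorem IsFormOn.contDiffOn_toForm (hg : IsFormOn V g) : ContDiffOn ℝ ∞ (toForm g) V := by
  obtain ⟨L, hL⟩ := (basisEval r n).exists_leftInverse_of_injective
    (LinearMap.ker_eq_bot.2 basisEval_injective)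
  have h : ContDiffOn ℝ ∞ (fun x (s : Fin n → Fin r) => g x fun i => Pi.single (s i) 1) V :=
    contDiffOn_pi.2 fun s => hg.2 _
  refine ((LinearMap.toContinuousLinearMap L).contDiff.comp_contDiffOn h).congr fun x hx => ?_
  have := LinearMap.congr_fun hL (toForm g x)
  refine this.symm.trans (congrArg L (funext fun s => ?_))
  exact toForm_apply (hg.1 x hx) _

theorem IsFormOn.extDeriv_apply (hV : IsOpen V) (hg : IsFormOn V g) (hx : x ∈ V)
    (v : Fin (n + 1) → Vec r) :
    extDeriv (toForm g) x v =
      ∑ i : Fin (n + 1), (-1 : ℝ) ^ (i : ℕ) *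
        fderiv ℝ (fun y => g y (v ∘ i.succAbove)) x (v i) := by
  rw [_root_.extDeriv_apply ((hg.contDiffOn_toForm.contDiffAt
    (hV.mem_nhds hx)).differentiableAt (by simp))]
  refine Finset.sum_congr rfl fun i _ => ?_
  have : (fun y => toForm g y (i.removeNth v)) =ᶠ[𝓝 x] fun y => g y (v ∘ i.succAbove) := by
    filter_upwards [hV.mem_nhds hx] with y hy
    exact toForm_apply (hg.1 y hy) _
  rw [this.fderiv_eq, zsmul_eq_mul]
  push_cast
  rfl

/-- The exterior derivative of a form given by its values. -/
def extD (g : Vec r → (Fin n → Vec r) → ℝ) : Vec r → (Fin (n + 1) → Vec r) → ℝ := fun x v =>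
  ∑ i : Fin (n + 1), (-1 : ℝ) ^ (i : ℕ) * fderiv ℝ (fun y => g y (v ∘ i.succAbove)) x (v i)

theorem IsFormOn.extD (hV : IsOpen V) (hg : IsFormOn V g) : IsFormOn V (extD g) := by
  refine ⟨fun x hx => ?_, fun v => ?_⟩
  · rw [show _root_.extD g x = extDeriv (toForm g) x from
      funext fun v => (hg.extDeriv_apply hV hx v).symm]
    exact isAltML_coe _
  · exact ContDiffOn.sum fun i _ => contDiffOn_const.mul
      (((hg.2 _).fderiv_of_isOpen hV le_rfl).clm_apply contDiffOn_const)

theorem IsFormOn.toForm_extD (hV : IsOpen V) (hg : IsFormOn V g) (hx : x ∈ V) :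
    toForm (_root_.extD g) x = extDeriv (toForm g) x := by
  ext v
  rw [toForm_apply ((hg.extD hV).1 x hx), hg.extDeriv_apply hV hx]; rfl

theorem IsFormOn.extD_extD (hV : IsOpen V) (hg : IsFormOn V g) (hx : x ∈ V)
    (v : Fin (n + 2) → Vec r) : _root_.extD (_root_.extD g) x v = 0 := by
  have h : toForm (_root_.extD g) =ᶠ[𝓝 x] extDeriv (toForm g) := by
    filter_upwards [hV.mem_nhds hx] with y hy using hg.toForm_extD hV hy
  rw [_root_.extD, ← (hg.extD hV).extDeriv_apply hV hx, h.extDeriv_eq,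
    extDeriv_extDeriv_apply (hg.contDiffOn_toForm.contDiffAt (hV.mem_nhds hx))
      (by simpa using WithTop.coe_le_coe.2 (le_top : (2 : ℕ∞) ≤ ⊤))]
  rfl

/-- The radial homotopy operator with centre `z` on forms given by their values. -/
def radial (z : Vec r) (g : Vec r → (Fin (n + 1) → Vec r) → ℝ) :
    Vec r → (Fin n → Vec r) → ℝ := fun x v =>
  ∫ t in (0 : ℝ)..1, t ^ n * g (z + t • (x - z)) (Fin.cons (x - z) v)

variable {z : Vec r} {g : Vec r → (Fin (n + 1) → Vec r) → ℝ}

theorem IsFormOn.continuousOn_segment (hg : IsFormOn V g)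
    (hstar : ∀ x ∈ V, ∀ t ∈ Icc (0 : ℝ) 1, z + t • (x - z) ∈ V) (hx : x ∈ V)
    (v : Fin (n + 1) → Vec r) :
    ContinuousOn (fun t : ℝ => t ^ n * g (z + t • (x - z)) v) (Icc 0 1) :=
  (continuousOn_pow n).mul ((hg.2 v).continuousOn.comp
    (f := fun t : ℝ => z + t • (x - z)) (by fun_prop) (hstar x hx))

theorem IsFormOn.radial_eq (hg : IsFormOn V g)
    (hstar : ∀ x ∈ V, ∀ t ∈ Icc (0 : ℝ) 1, z + t • (x - z) ∈ V) (hx : x ∈ V) :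
    radial z g x = ⇑(∫ t in (0 : ℝ)..1,
      t ^ n • (toForm g (z + t • (x - z))).curryLeft (x - z)) := by
  have hc : ContinuousOn (fun t : ℝ => t ^ n • (toForm g (z + t • (x - z))).curryLeft (x - z))
      (Icc 0 1) := by
    have h1 := (hg.contDiffOn_toForm.continuousOn).comp
      (f := fun t : ℝ => z + t • (x - z)) (by fun_prop) (hstar x hx)
    have h2 := (ContinuousAlternatingMap.curryLeftLI (𝕜 := ℝ) (E := Vec r) (F := ℝ)
      (n := n)).continuous.comp_continuousOn h1
    exact (continuousOn_pow n).smul (h2.clm_apply continuousOn_const)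
  funext v
  have := ContinuousLinearMap.intervalIntegral_comp_comm
    (μ := MeasureTheory.volume) (ContinuousAlternatingMap.apply ℝ (Vec r) ℝ v)
    (hc.intervalIntegrable_of_Icc zero_le_one)
  refine Eq.trans ?_ this
  refine intervalIntegral.integral_congr fun t ht => ?_
  rw [uIcc_of_le zero_le_one] at ht
  exact congrArg (t ^ n * ·) (toForm_apply (hg.1 _ (hstar x hx t ht)) _).symm

theorem IsFormOn.radial (hV : IsOpen V) (hg : IsFormOn V g)
    (hstar : ∀ x ∈ V, ∀ t ∈ Icc (0 : ℝ) 1, z + t • (x - z) ∈ V) :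
    IsFormOn V (radial z g) := by
  refine ⟨fun x hx => ?_, fun v => ?_⟩
  · rw [hg.radial_eq hstar hx]
    exact isAltML_coe _
  · have h := contDiffOn_radialHomotopy n (ContinuousAlternatingMap.curryLeftLI (𝕜 := ℝ)
      (E := Vec r) (F := ℝ) (n := n)).toContinuousLinearMap hV hstar hg.contDiffOn_toForm
    refine ((ContinuousAlternatingMap.apply ℝ (Vec r) ℝ v).contDiff.comp_contDiffOn h).congr
      fun x hx => ?_
    exact congrFun (hg.radial_eq hstar hx) v

/-- The Poincaré lemma on star shaped open sets, for forms given by their values. -/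
theorem IsFormOn.extD_radial (hV : IsOpen V) (hg : IsFormOn V g)
    (hstar : ∀ x ∈ V, ∀ t ∈ Icc (0 : ℝ) 1, z + t • (x - z) ∈ V)
    (hclosed : ∀ x ∈ V, ∀ v, _root_.extD g x v = 0) (hx : x ∈ V) (v : Fin (n + 1) → Vec r) :
    _root_.extD (_root_.radial z g) x v = g x v := by
  have h : toForm (_root_.radial z g) =ᶠ[𝓝 x] fun x => ∫ t in (0 : ℝ)..1,
      t ^ n • (toForm g (z + t • (x - z))).curryLeft (x - z) := by
    filter_upwards [hV.mem_nhds hx] with y hy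
    ext u
    rw [toForm_apply ((hg.radial hV hstar).1 y hy), hg.radial_eq hstar hy]
  rw [_root_.extD, ← (hg.radial hV hstar).extDeriv_apply hV hx, h.extDeriv_eq,
    extDeriv_radialHomotopy hV hstar hg.contDiffOn_toForm (fun y hy => ?_) hx,
    toForm_apply (hg.1 x hx)]
  ext u
  rw [hg.extDeriv_apply hV hy]
  exact hclosed y hy u

end Form

section Closure

variable {r n : ℕ} {V : Set (Vec r)} {x : Vec r}

theorem IsAltML.sub {f g : (Fin n → Vec r) → ℝ} (hf : IsAltML f) (hg : IsAltML g) :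
    IsAltML fun v => f v - g v :=
  isAltML_coe (hf.toContinuousAlternatingMap - hg.toContinuousAlternatingMap)

theorem IsAltML.const_mul {f : (Fin n → Vec r) → ℝ} (hf : IsAltML f) (c : ℝ) :
    IsAltML fun v => c * f v :=
  ⟨fun v i x y => by simp only [hf.1, mul_add],
    fun v i a x => by simp only [hf.2.1, mul_left_comm],
    fun v i j hij hv => by simp only [hf.2.2 v i j hij hv, mul_zero]⟩

theorem IsAltML.sum {ι : Type} (s : Finset ι) {f : ι → (Fin n → Vec r) → ℝ}
    (hf : ∀ j, IsAltML (f j)) : IsAltML fun v => ∑ j ∈ s, f j v :=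
  ⟨fun v i x y => by simp only [(hf _).1, Finset.sum_add_distrib],
    fun v i a x => by simp only [(hf _).2.1, Finset.mul_sum],
    fun v i j hij hv => Finset.sum_eq_zero fun k _ => (hf k).2.2 v i j hij hv⟩

theorem IsAltML.intervalIntegral {g : ℝ → (Fin n → Vec r) → ℝ}
    (hg : ∀ t ∈ Icc (0 : ℝ) 1, IsAltML (g t))
    (hc : ∀ v, ContinuousOn (fun t => g t v) (Icc 0 1)) :
    IsAltML fun v => ∫ t in (0 : ℝ)..1, g t v := by
  rw [← uIcc_of_le zero_le_one] at hg
  refine ⟨fun v i x y => ?_, fun v i c x => ?_, fun v i j hij hv => ?_⟩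
  · rw [← intervalIntegral.integral_add ((hc _).intervalIntegrable_of_Icc zero_le_one)
      ((hc _).intervalIntegrable_of_Icc zero_le_one)]
    exact intervalIntegral.integral_congr fun t ht => (hg t ht).1 v i x y
  · rw [← intervalIntegral.integral_const_mul]
    exact intervalIntegral.integral_congr fun t ht => (hg t ht).2.1 v i c x
  · exact (intervalIntegral.integral_congr fun t ht => (hg t ht).2.2 v i j hij hv).trans
      intervalIntegral.integral_zero

theorem IsFormOn.isAltML_fderiv (hV : IsOpen V) {g : Vec r → (Fin n → Vec r) → ℝ}
    (hg : IsFormOn V g) (hx : x ∈ V) (u : Vec r) :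
    IsAltML fun v => fderiv ℝ (fun y => g y v) x u := by
  have hd : DifferentiableAt ℝ (toForm g) x :=
    (hg.contDiffOn_toForm.contDiffAt (hV.mem_nhds hx)).differentiableAt (by simp)
  convert isAltML_coe (fderiv ℝ (toForm g) x u) using 1
  funext v
  have : (fun y => g y v) =ᶠ[𝓝 x] fun y => ContinuousAlternatingMap.apply ℝ (Vec r) ℝ v
      (toForm g y) := by
    filter_upwards [hV.mem_nhds hx] with y hy using (toForm_apply (hg.1 y hy) v).symm
  rw [((ContinuousAlternatingMap.apply ℝ (Vec r) ℝ v).hasFDerivAt.comp x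
    hd.hasFDerivAt |>.congr_of_eventuallyEq this).fderiv]
  rfl

theorem extD_congr (hV : IsOpen V) {g h : Vec r → (Fin n → Vec r) → ℝ}
    (hgh : ∀ y ∈ V, ∀ v, g y v = h y v) (hx : x ∈ V) (v : Fin (n + 1) → Vec r) :
    extD g x v = extD h x v := by
  refine Finset.sum_congr rfl fun i _ => ?_
  rw [Filter.EventuallyEq.fderiv_eq (f₁ := fun y => g y (v ∘ i.succAbove))
    (Filter.mem_of_superset (hV.mem_nhds hx) fun y hy => hgh y hy _)]

theorem IsFormOn.differentiableAt (hV : IsOpen V) {g : Vec r → (Fin n → Vec r) → ℝ}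
    (hg : IsFormOn V g) (hx : x ∈ V) (v : Fin n → Vec r) :
    DifferentiableAt ℝ (fun y => g y v) x :=
  ((hg.2 v).contDiffAt (hV.mem_nhds hx)).differentiableAt (by simp)

theorem IsFormOn.extD_sub (hV : IsOpen V) {g h : Vec r → (Fin n → Vec r) → ℝ}
    (hg : IsFormOn V g) (hh : IsFormOn V h) (hx : x ∈ V) (v : Fin (n + 1) → Vec r) :
    _root_.extD (fun y v => g y v - h y v) x v = _root_.extD g x v - _root_.extD h x v := by
  simp only [_root_.extD, ← Finset.sum_sub_distrib, ← mul_sub]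
  refine Finset.sum_congr rfl fun i _ => ?_
  rw [fderiv_fun_sub (hg.differentiableAt hV hx _) (hh.differentiableAt hV hx _)]
  rfl

theorem extD_const_mul (c : ℝ) (g : Vec r → (Fin n → Vec r) → ℝ) (v : Fin (n + 1) → Vec r) :
    extD (fun y v => c * g y v) x v = c * extD g x v := by
  simp only [extD, Finset.mul_sum]
  refine Finset.sum_congr rfl fun i _ => ?_
  rw [show (fun y => c * g y (v ∘ i.succAbove)) = c • fun y => g y (v ∘ i.succAbove) from rfl,
    fderiv_const_smul_field]
  exact mul_left_comm _ _ _

theorem fderiv_fderiv_comm (hV : IsOpen V) {f : Vec r → ℝ} (hf : ContDiffOn ℝ ∞ f V)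
    (hx : x ∈ V) (u e : Vec r) :
    fderiv ℝ (fun y => fderiv ℝ f y u) x e = fderiv ℝ (fun y => fderiv ℝ f y e) x u := by
  have hd : DifferentiableAt ℝ (fderiv ℝ f) x :=
    ((hf.fderiv_of_isOpen hV (m := ∞) le_rfl).contDiffAt
      (hV.mem_nhds hx)).differentiableAt (by simp)
  have h : ∀ u, fderiv ℝ (fun y => fderiv ℝ f y u) x = (fderiv ℝ (fderiv ℝ f) x).flip u :=
    fun u => by
      rw [fderiv_clm_apply hd (differentiableAt_const u)]
      simp
  rw [h, h]
  exact (hf.contDiffAt (hV.mem_nhds hx)).isSymmSndFDerivAt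
    (by simpa using WithTop.coe_le_coe.2 (le_top : (2 : ℕ∞) ≤ ⊤)) e u

theorem fderiv_sum_mul_fderiv (hV : IsOpen V) {ι : Type} (s : Finset ι) (a : ι → ℝ)
    {f : ι → Vec r → ℝ} (hf : ∀ i, ContDiffOn ℝ ∞ (f i) V) (hx : x ∈ V)
    (u : ι → Vec r) (e : Vec r) :
    fderiv ℝ (fun y => ∑ i ∈ s, a i * fderiv ℝ (f i) y (u i)) x e =
      ∑ i ∈ s, a i * fderiv ℝ (fun y => fderiv ℝ (f i) y (u i)) x e := by
  have hd : ∀ i, DifferentiableAt ℝ (fun y => fderiv ℝ (f i) y (u i)) x := fun i =>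
    ((((hf i).fderiv_of_isOpen hV (m := ∞) le_rfl).clm_apply contDiffOn_const).contDiffAt
      (hV.mem_nhds hx)).differentiableAt (by simp)
  rw [fderiv_fun_sum fun i _ => (hd i).const_mul (a i)]
  simp [fderiv_const_mul (hd _)]

end Closure

section Superform

variable {r p q : ℕ} {V : Set (Vec r)} {z x : Vec r}

theorem IsSuperformOn.left {α : SFd r p q} (h : IsSuperformOn V α) (w : Fin q → Vec r) :
    IsFormOn V fun x v => α x v w :=
  ⟨fun x hx => h.1 x hx w, fun v => h.2.2 v w⟩

theorem IsSuperformOn.right {α : SFd r p q} (h : IsSuperformOn V α) (v : Fin p → Vec r) :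
    IsFormOn V fun x w => α x v w :=
  ⟨fun x hx => h.2.1 x hx v, fun w => h.2.2 v w⟩

theorem IsSuperformOn.sub {α β : SFd r p q} (hα : IsSuperformOn V α) (hβ : IsSuperformOn V β) :
    IsSuperformOn V fun x v w => α x v w - β x v w :=
  ⟨fun x hx w => (hα.1 x hx w).sub (hβ.1 x hx w),
    fun x hx v => (hα.2.1 x hx v).sub (hβ.2.1 x hx v),
    fun v w => (hα.2.2 v w).sub (hβ.2.2 v w)⟩

theorem IsSuperformOn.zero : IsSuperformOn V (fun _ _ _ => 0 : SFd r p q) :=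
  ⟨fun _ _ _ => isAltML_coe 0, fun _ _ _ => isAltML_coe 0, fun _ _ => contDiffOn_const⟩

theorem IsSuperformOn.dPP (hV : IsOpen V) {α : SFd r p q} (h : IsSuperformOn V α) :
    IsSuperformOn V (dPP α) :=
  ⟨fun _ hx w => (IsAltML.sum _ fun j =>
      ((h.left (w ∘ j.succAbove)).isAltML_fderiv hV hx (w j)).const_mul _).const_mul _,
    fun x hx v => (((h.right v).extD hV).1 x hx).const_mul _,
    fun v w => contDiffOn_const.mul (((h.right v).extD hV).2 w)⟩

theorem dP_congr (hV : IsOpen V) {α β : SFd r p q} (h : ∀ y ∈ V, ∀ v w, α y v w = β y v w)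
    (hx : x ∈ V) (v : Fin (p + 1) → Vec r) (w : Fin q → Vec r) : dP α x v w = dP β x v w :=
  extD_congr hV (fun y hy v => h y hy v w) hx v

theorem dPP_congr (hV : IsOpen V) {α β : SFd r p q} (h : ∀ y ∈ V, ∀ v w, α y v w = β y v w)
    (hx : x ∈ V) (v : Fin p → Vec r) (w : Fin (q + 1) → Vec r) : dPP α x v w = dPP β x v w :=
  congrArg _ (extD_congr hV (fun y hy w => h y hy v w) hx w)

theorem dP_zero (v : Fin (p + 1) → Vec r) (w : Fin q → Vec r) :
    dP (fun _ _ _ => 0) x v w = 0 := by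
  simp [dP]

theorem dPP_zero (v : Fin p → Vec r) (w : Fin (q + 1) → Vec r) :
    dPP (fun _ _ _ => 0) x v w = 0 := by
  simp [dPP]

theorem dP_sub (hV : IsOpen V) {α β : SFd r p q} (hα : IsSuperformOn V α)
    (hβ : IsSuperformOn V β) (hx : x ∈ V) (v : Fin (p + 1) → Vec r) (w : Fin q → Vec r) :
    dP (fun x v w => α x v w - β x v w) x v w = dP α x v w - dP β x v w :=
  (hα.left w).extD_sub hV (hβ.left w) hx v

theorem dPP_sub (hV : IsOpen V) {α β : SFd r p q} (hα : IsSuperformOn V α)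
    (hβ : IsSuperformOn V β) (hx : x ∈ V) (v : Fin p → Vec r) (w : Fin (q + 1) → Vec r) :
    dPP (fun x v w => α x v w - β x v w) x v w = dPP α x v w - dPP β x v w :=
  (congrArg _ ((hα.right v).extD_sub hV (hβ.right v) hx w)).trans (mul_sub _ _ _)

theorem dPP_dPP (hV : IsOpen V) {α : SFd r p q} (hα : IsSuperformOn V α) (hx : x ∈ V)
    (v : Fin p → Vec r) (w : Fin (q + 2) → Vec r) : dPP (dPP α) x v w = 0 := by
  change (-1 : ℝ) ^ p * extD (fun y w => (-1 : ℝ) ^ p * extD (fun y w => α y v w) y w) x w = 0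
  rw [extD_const_mul, (hα.right v).extD_extD hV hx, mul_zero, mul_zero]

theorem dP_dPP (hV : IsOpen V) {α : SFd r p q} (hα : IsSuperformOn V α) (hx : x ∈ V)
    (v : Fin (p + 1) → Vec r) (w : Fin (q + 1) → Vec r) :
    dP (dPP α) x v w = -dPP (dP α) x v w := by
  have h1 : ∀ i : Fin (p + 1), fderiv ℝ (fun y => dPP α y (v ∘ i.succAbove) w) x (v i) =
      (-1 : ℝ) ^ p * ∑ j : Fin (q + 1), (-1 : ℝ) ^ (j : ℕ) *
        fderiv ℝ (fun y => fderiv ℝ (fun y => α y (v ∘ i.succAbove) (w ∘ j.succAbove)) y (w j))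
          x (v i) := fun i => by
    simp only [dPP, Finset.mul_sum, ← mul_assoc]
    exact fderiv_sum_mul_fderiv hV _ _ (fun j => hα.2.2 _ _) hx _ _
  have h2 : ∀ j : Fin (q + 1), fderiv ℝ (fun y => dP α y v (w ∘ j.succAbove)) x (w j) =
      ∑ i : Fin (p + 1), (-1 : ℝ) ^ (i : ℕ) *
        fderiv ℝ (fun y => fderiv ℝ (fun y => α y (v ∘ i.succAbove) (w ∘ j.succAbove)) y (w j))
          x (v i) := fun j => by
    refine (fderiv_sum_mul_fderiv hV _ _ (fun i => hα.2.2 _ _) hx _ _).trans ?_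
    exact Finset.sum_congr rfl fun i _ => by rw [fderiv_fderiv_comm hV (hα.2.2 _ _) hx]
  rw [dP, dPP]
  simp only [h1, h2, Finset.mul_sum, ← Finset.sum_neg_distrib]
  rw [Finset.sum_comm]
  refine Finset.sum_congr rfl fun j _ => Finset.sum_congr rfl fun i _ => ?_
  ring

/-- The homotopy operator for `d'` on a star shaped set with centre `z`. -/
def kP (z : Vec r) (β : SFd r (p + 1) q) : SFd r p q := fun x v w =>
  radial z (fun y v => β y v w) x v

theorem kP_eq_zero (hstar : ∀ x ∈ V, ∀ t ∈ Icc (0 : ℝ) 1, z + t • (x - z) ∈ V)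
    {β : SFd r (p + 1) q} (h : ∀ y ∈ V, ∀ v w, β y v w = 0) (hx : x ∈ V)
    (v : Fin p → Vec r) (w : Fin q → Vec r) : kP z β x v w = 0 := by
  refine (intervalIntegral.integral_congr fun t ht => ?_).trans intervalIntegral.integral_zero
  rw [uIcc_of_le zero_le_one] at ht
  simp [h _ (hstar x hx t ht)]

theorem IsSuperformOn.kP (hV : IsOpen V)
    (hstar : ∀ x ∈ V, ∀ t ∈ Icc (0 : ℝ) 1, z + t • (x - z) ∈ V)
    {β : SFd r (p + 1) q} (hβ : IsSuperformOn V β) : IsSuperformOn V (kP z β) :=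
  ⟨fun x hx w => ((hβ.left w).radial hV hstar).1 x hx,
    fun x hx _ => IsAltML.intervalIntegral
      (fun t ht => ((hβ.right _).1 _ (hstar x hx t ht)).const_mul _)
      fun w => (hβ.left w).continuousOn_segment hstar hx _,
    fun v w => ((hβ.left w).radial hV hstar).2 v⟩

/-- The `d'`-Poincaré lemma on star shaped open sets. -/
theorem dP_kP (hV : IsOpen V) (hstar : ∀ x ∈ V, ∀ t ∈ Icc (0 : ℝ) 1, z + t • (x - z) ∈ V)
    {β : SFd r (p + 1) q} (hβ : IsSuperformOn V β) (hclosed : ∀ x ∈ V, ∀ v w, dP β x v w = 0)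
    (hx : x ∈ V) (v : Fin (p + 1) → Vec r) (w : Fin q → Vec r) :
    dP (_root_.kP z β) x v w = β x v w :=
  (hβ.left w).extD_radial hV hstar (fun y hy v => hclosed y hy v w) hx v

end Superform

section Reduction

variable {r k : ℕ} {V : Set (Vec r)} {z x : Vec r} {α : Tot r}

/-- The components `β` of the reduction, by bidegree `(p,q)` and recursively in `q`: each solves
`d'β = α - d''β'` for the preceding component `β'` by means of the homotopy operator. -/
def primitive (z : Vec r) (α : Tot r) : ∀ q p : ℕ, SFd r p q
  | 0, p => kP z (α (p + 1) 0)
  | q + 1, p => kP z fun x v w => α (p + 1) (q + 1) x v w - dPP (primitive z α q (p + 1)) x v w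

/-- The superform `α - d''β` for the components `β` of `primitive`. -/
def residue (z : Vec r) (α : Tot r) : Tot r := fun p q x v w =>
  α p q x v w - Dpp (fun p q => primitive z α q p) p q x v w

theorem primitive_eq (z : Vec r) (α : Tot r) (p q : ℕ) :
    primitive z α q p = kP z (residue z α (p + 1) q) := by
  cases q with
  | zero => exact congrArg (kP z) (by ext x v w; exact (sub_zero _).symm)
  | succ q => rfl

theorem isSuperformOn_residue (hV : IsOpen V)
    (hstar : ∀ x ∈ V, ∀ t ∈ Icc (0 : ℝ) 1, z + t • (x - z) ∈ V)
    (hα : ∀ p q, IsSuperformOn V (α p q)) (p q : ℕ) : IsSuperformOn V (residue z α p q) := by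
  induction q generalizing p with
  | zero => exact (hα p 0).sub .zero
  | succ q ih =>
    refine (hα p (q + 1)).sub (.dPP hV ?_)
    simp only [primitive_eq]
    exact (ih (p + 1)).kP hV hstar

theorem isSuperformOn_primitive (hV : IsOpen V)
    (hstar : ∀ x ∈ V, ∀ t ∈ Icc (0 : ℝ) 1, z + t • (x - z) ∈ V)
    (hα : ∀ p q, IsSuperformOn V (α p q)) (p q : ℕ) : IsSuperformOn V (primitive z α q p) := by
  rw [primitive_eq]
  exact (isSuperformOn_residue hV hstar hα _ _).kP hV hstar

theorem dP_residue (hV : IsOpen V)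
    (hstar : ∀ x ∈ V, ∀ t ∈ Icc (0 : ℝ) 1, z + t • (x - z) ∈ V)
    (hα : ∀ p q, IsSuperformOn V (α p q))
    (hclosed : ∀ p q, ∀ x ∈ V, ∀ v w, Dtot α p q x v w = 0) (p q : ℕ) (hx : x ∈ V)
    (v : Fin (p + 1) → Vec r) (w : Fin q → Vec r) : dP (residue z α p q) x v w = 0 := by
  induction q generalizing p x with
  | zero =>
    have h := hclosed (p + 1) 0 x hx v w
    simp only [Dtot, Dp, Dpp, add_zero] at h
    rw [← h]
    exact dP_congr hV (fun y _ v w => sub_zero _) hx v w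
  | succ q ih =>
    have hβ := isSuperformOn_primitive hV hstar hα p q
    have h : ∀ y ∈ V, ∀ v w, dP (primitive z α q p) y v w = residue z α (p + 1) q y v w := by
      intro y hy v w
      rw [primitive_eq]
      exact dP_kP hV hstar (isSuperformOn_residue hV hstar hα _ _)
        (fun x hx v w => ih (p + 1) hx v w) hy v w
    have h0 : dPP (Dpp (fun p q => primitive z α q p) (p + 1) q) x v w = 0 := by
      cases q with
      | zero => exact dPP_zero v w
      | succ q => exact dPP_dPP hV (isSuperformOn_primitive hV hstar hα _ _) hx v w
    have hs : IsSuperformOn V (Dpp (fun p q => primitive z α q p) (p + 1) q) := by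
      cases q with
      | zero => exact .zero
      | succ q => exact .dPP hV (isSuperformOn_primitive hV hstar hα _ _)
    have hc : dP (α p (q + 1)) x v w + dPP (α (p + 1) q) x v w = 0 :=
      hclosed (p + 1) (q + 1) x hx v w
    calc dP (residue z α p (q + 1)) x v w
        = dP (α p (q + 1)) x v w - dP (dPP (primitive z α q p)) x v w :=
          dP_sub hV (hα _ _) (hβ.dPP hV) hx v w
      _ = dP (α p (q + 1)) x v w + dPP (residue z α (p + 1) q) x v w := by
          rw [dP_dPP hV hβ hx, sub_neg_eq_add, dPP_congr hV h hx]
      _ = dP (α p (q + 1)) x v w + (dPP (α (p + 1) q) x v w - 0) := by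
          rw [← h0]
          exact congrArg _ (dPP_sub hV (hα _ _) hs hx v w)
      _ = 0 := by rw [sub_zero, hc]

theorem dP_primitive (hV : IsOpen V)
    (hstar : ∀ x ∈ V, ∀ t ∈ Icc (0 : ℝ) 1, z + t • (x - z) ∈ V)
    (hα : ∀ p q, IsSuperformOn V (α p q))
    (hclosed : ∀ p q, ∀ x ∈ V, ∀ v w, Dtot α p q x v w = 0) (p q : ℕ) (hx : x ∈ V)
    (v : Fin (p + 1) → Vec r) (w : Fin q → Vec r) :
    dP (primitive z α q p) x v w = residue z α (p + 1) q x v w := by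
  rw [primitive_eq]
  exact dP_kP hV hstar (isSuperformOn_residue hV hstar hα _ _)
    (fun y hy v w => dP_residue hV hstar hα hclosed _ _ hy v w) hx v w

theorem residue_eq_zero (hV : IsOpen V)
    (hstar : ∀ x ∈ V, ∀ t ∈ Icc (0 : ℝ) 1, z + t • (x - z) ∈ V) (hhom : IsHomogOn V k α)
    {p q : ℕ} (hpq : p + q ≠ k) (hx : x ∈ V) (v : Fin p → Vec r) (w : Fin q → Vec r) :
    residue z α p q x v w = 0 := by
  induction q generalizing p x with
  | zero => exact (sub_zero _).trans (hhom p 0 hpq x hx v w)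
  | succ q ih =>
    have h : dPP (primitive z α q p) x v w = 0 := by
      rw [← dPP_zero (x := x) v w]
      refine dPP_congr hV (fun y hy v w => ?_) hx v w
      rw [primitive_eq]
      exact kP_eq_zero hstar (fun y hy v w => ih (by omega) hy v w) hy v w
    exact (congrArg₂ _ (hhom p (q + 1) hpq x hx v w) h).trans (sub_zero 0)

theorem isHomogOn_primitive (hV : IsOpen V)
    (hstar : ∀ x ∈ V, ∀ t ∈ Icc (0 : ℝ) 1, z + t • (x - z) ∈ V) (hhom : IsHomogOn V k α) :
    IsHomogOn V (k - 1) fun p q => primitive z α q p := fun p q hpq x hx v w => by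
  simp only [primitive_eq]
  exact kP_eq_zero hstar (fun y hy v w => residue_eq_zero hV hstar hhom (by omega) hy v w) hx v w

theorem sub_Dtot_primitive_zero (q : ℕ) (v : Fin 0 → Vec r) (w : Fin q → Vec r) :
    α 0 q x v w - Dtot (fun p q => primitive z α q p) 0 q x v w = residue z α 0 q x v w := by
  simp [Dtot, Dp, residue]

theorem sub_Dtot_primitive_succ (hV : IsOpen V)
    (hstar : ∀ x ∈ V, ∀ t ∈ Icc (0 : ℝ) 1, z + t • (x - z) ∈ V)
    (hα : ∀ p q, IsSuperformOn V (α p q))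
    (hclosed : ∀ p q, ∀ x ∈ V, ∀ v w, Dtot α p q x v w = 0) (p q : ℕ) (hx : x ∈ V)
    (v : Fin (p + 1) → Vec r) (w : Fin q → Vec r) :
    α (p + 1) q x v w - Dtot (fun p q => primitive z α q p) (p + 1) q x v w = 0 := by
  simp only [Dtot, Dp, dP_primitive hV hstar hα hclosed p q hx, residue]
  ring

theorem dPP_residue_zero (hV : IsOpen V)
    (hstar : ∀ x ∈ V, ∀ t ∈ Icc (0 : ℝ) 1, z + t • (x - z) ∈ V)
    (hα : ∀ p q, IsSuperformOn V (α p q))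
    (hclosed : ∀ p q, ∀ x ∈ V, ∀ v w, Dtot α p q x v w = 0) (q : ℕ) (hx : x ∈ V)
    (v : Fin 0 → Vec r) (w : Fin (q + 1) → Vec r) : dPP (residue z α 0 q) x v w = 0 := by
  have hc : dPP (α 0 q) x v w = 0 := (zero_add _).symm.trans (hclosed 0 (q + 1) x hx v w)
  cases q with
  | zero => exact (dPP_congr hV (fun y _ v w => sub_zero _) hx v w).trans hc
  | succ q =>
    have hβ := isSuperformOn_primitive hV hstar hα 0 q
    refine (dPP_sub hV (hα _ _) (hβ.dPP hV) hx v w).trans ?_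
    rw [hc, dPP_dPP hV hβ hx, sub_zero]

end Reduction

end Material

/-- on a star shaped open `V ⊆ ℝ^r`, for every `d`-closed
mixed-degree superform `α` of total degree `k` there is `β ∈ A^{k-1}(V)` with
`γ := α − dβ ∈ A^{0,k}(V)`, and `γ` is `d'`-, `d''`- and `d`-closed; if
moreover `k > r` then `α` is `d`-exact. -/
theorem d_closed_reduction {r k : ℕ} (V : Set (Vec r)) (hV : IsOpen V)
    (z : Vec r) (hstar : ∀ x ∈ V, ∀ t ∈ Icc (0 : ℝ) 1, z + t • (x - z) ∈ V)
    (α : Tot r) (hαs : ∀ p q, IsSuperformOn V (α p q))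
    (hhom : IsHomogOn V k α)
    (hclosed : ∀ p q, ∀ x ∈ V, ∀ v w, Dtot α p q x v w = 0) :
    (∃ β γ : Tot r,
      (∀ p q, IsSuperformOn V (β p q)) ∧ IsHomogOn V (k - 1) β ∧
      (∀ p q x v w, γ p q x v w = α p q x v w - Dtot β p q x v w) ∧
      (∀ p q : ℕ, p ≠ 0 → ∀ x ∈ V, ∀ v w, γ p q x v w = 0) ∧
      (∀ p q, ∀ x ∈ V, ∀ v w, Dp γ p q x v w = 0) ∧
      (∀ p q, ∀ x ∈ V, ∀ v w, Dpp γ p q x v w = 0) ∧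
      (∀ p q, ∀ x ∈ V, ∀ v w, Dtot γ p q x v w = 0)) ∧
    (k > r → ∃ β : Tot r, (∀ p q, IsSuperformOn V (β p q)) ∧
      ∀ p q, ∀ x ∈ V, ∀ v w, Dtot β p q x v w = α p q x v w) := by
  have hγ : ∀ p q : ℕ, p ≠ 0 → ∀ x ∈ V, ∀ v w,
      α p q x v w - Dtot (fun p q => primitive z α q p) p q x v w = 0 := by
    rintro (_ | p) q hp x hx v w
    · exact absurd rfl hp
    · exact sub_Dtot_primitive_succ hV hstar hαs hclosed p q hx v w
  have hDp : ∀ p q, ∀ x ∈ V, ∀ v w, Dp (fun p q x v w =>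
      α p q x v w - Dtot (fun p q => primitive z α q p) p q x v w) p q x v w = 0 := by
    rintro (_ | _ | p) q x hx v w
    · rfl
    · exact (dP_congr hV (fun y _ v w => sub_Dtot_primitive_zero q v w) hx v w).trans
        (dP_residue hV hstar hαs hclosed 0 q hx v w)
    · exact (dP_congr hV (fun y hy v w => hγ (p + 1) q (by omega) y hy v w) hx v w).trans
        (dP_zero v w)
  have hDpp : ∀ p q, ∀ x ∈ V, ∀ v w, Dpp (fun p q x v w =>
      α p q x v w - Dtot (fun p q => primitive z α q p) p q x v w) p q x v w = 0 := by
    rintro (_ | p) (_ | q) x hx v w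
    · rfl
    · exact (dPP_congr hV (fun y _ v w => sub_Dtot_primitive_zero q v w) hx v w).trans
        (dPP_residue_zero hV hstar hαs hclosed q hx v w)
    · rfl
    · exact (dPP_congr hV (fun y hy v w => hγ (p + 1) q (by omega) y hy v w) hx v w).trans
        (dPP_zero v w)
  have hβ := fun p q => isSuperformOn_primitive hV hstar hαs p q
  refine ⟨⟨_, _, hβ, isHomogOn_primitive hV hstar hhom, fun _ _ _ _ _ => rfl, hγ, hDp, hDpp,
    fun p q x hx v w => ?_⟩, fun hk => ⟨_, hβ, fun p q x hx v w => ?_⟩⟩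
  · rw [Dtot, hDp p q x hx, hDpp p q x hx, add_zero]
  · refine (sub_eq_zero.1 ?_).symm
    obtain _ | p := p
    · rw [sub_Dtot_primitive_zero]
      by_cases hq : q = k
      · exact ((isSuperformOn_residue hV hstar hαs 0 q).2.1 x hx v).toAlternatingMap.eq_zero_of_lt
          (hq ▸ hk) w
      · exact residue_eq_zero hV hstar hhom (by omega) hx v w
    · exact hγ (p + 1) q (by omega) x hx v w
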